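/- arXiv:1104.2722 — 2 statements merged into one kernel-verified Lean document; each statement's English description precedes it below -/
import Mathlib

section
/- For every f ∈ V and every α ∈ Fin n, the variational derivative annihilates total x-derivatives: δ_α(D(f)) = 0. (The statement that ∮ ∂_x f dx = 0, i.e. that functionals are well defined modulo total derivatives, in the form used throughout the paper.) -/
open MvPolynomial

noncomputable section

/-- The algebra of differential polynomials in `n` dependent variables:
variable `(γ, k)` is the `k`-th `x`-derivative of the `γ`-th dependent variable. -/
abbrev V (n : ℕ) : Type := MvPolynomial (Fin n × ℕ) ℚ

/-- The total `x`-derivative: the unique `ℚ`-linear derivation with `D (v (γ,k)) = v (γ,k+1)`. -/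
def D (n : ℕ) : V n → V n :=
  ⇑(MvPolynomial.mkDerivation ℚ (fun p : Fin n × ℕ => (X (p.1, p.2 + 1) : V n)))

/-- The variational derivative `δ_α f = Σ_s (−1)^s D^s(∂_{α,s} f)`. -/
def vder (n : ℕ) (α : Fin n) (f : V n) : V n :=
  ∑ᶠ s : ℕ, (-1 : V n) ^ s * (D n)^[s] (pderiv (α, s) f)

def DD (n : ℕ) : Derivation ℚ (V n) (V n) :=
  MvPolynomial.mkDerivation ℚ (fun p : Fin n × ℕ => (X (p.1, p.2 + 1) : V n))

lemma D_eq (n : ℕ) (f : V n) : D n f = DD n f := rfl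

lemma DD_X (n : ℕ) (p : Fin n × ℕ) : DD n (X p) = X (p.1, p.2 + 1) := by
  simp [DD, mkDerivation_X]

lemma comm_zero (n : ℕ) (α : Fin n) (f : V n) :
    pderiv (α, 0) (D n f) = D n (pderiv (α, 0) f) := by
  have h : ⁅(pderiv (α, 0) : Derivation ℚ (V n) (V n)), DD n⁆ = 0 := by
    apply MvPolynomial.derivation_ext
    rintro ⟨b, k⟩
    rw [Derivation.commutator_apply, DD_X, pderiv_X, pderiv_X]
    by_cases h : (α, 0) = (b, k)
    · rw [← h]; simp [Pi.single_apply]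
    · simp [Pi.single_apply, Ne.symm h, apply_ite (DD n)]
  have := congrArg (fun d => d f) h
  simp only [Derivation.commutator_apply, Derivation.coe_zero, Pi.zero_apply] at this
  exact sub_eq_zero.mp this

lemma comm_succ (n : ℕ) (α : Fin n) (s : ℕ) (f : V n) :
    pderiv (α, s + 1) (D n f) = D n (pderiv (α, s + 1) f) + pderiv (α, s) f := by
  have h : ⁅(pderiv (α, s + 1) : Derivation ℚ (V n) (V n)), DD n⁆ = pderiv (α, s) := by
    apply MvPolynomial.derivation_ext
    rintro ⟨b, k⟩
    rw [Derivation.commutator_apply, DD_X, pderiv_X, pderiv_X, pderiv_X]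
    simp [Pi.single_apply, apply_ite (DD n)]
  have := congrArg (fun d => d f) h
  simp only [Derivation.commutator_apply] at this
  exact sub_eq_iff_eq_add'.mp this

lemma D_iter_add (n s : ℕ) (f g : V n) :
    (D n)^[s] (f + g) = (D n)^[s] f + (D n)^[s] g :=
  iterate_map_add (DD n) s f g

lemma D_iter_zero (n s : ℕ) : (D n)^[s] 0 = 0 :=
  iterate_map_zero (DD n) s

lemma exists_bound (n : ℕ) (α : Fin n) (f : V n) :
    ∃ N, ∀ s, N ≤ s → pderiv (α, s) f = 0 := by
  refine ⟨f.vars.sup Prod.snd + 1, fun s hs => ?_⟩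
  apply pderiv_eq_zero_of_notMem_vars
  intro hm
  have := Finset.le_sup (f := Prod.snd) hm
  simp only at this
  omega

lemma partial_sum (n : ℕ) (α : Fin n) (f : V n) (N : ℕ) :
    ∑ s ∈ Finset.range (N + 1), (-1 : V n) ^ s * (D n)^[s] (pderiv (α, s) (D n f))
      = (-1) ^ N * (D n)^[N + 1] (pderiv (α, N) f) := by
  induction N with
  | zero => simp [comm_zero]
  | succ N ih =>
    rw [Finset.sum_range_succ, ih, comm_succ, D_iter_add, ← Function.iterate_succ_apply]
    ring

/-- The variational derivative annihilates total `x`-derivatives: `δ_α (D f) = 0`. -/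
theorem stmt4 (n : ℕ) (hn : 1 ≤ n) (f : V n) (α : Fin n) :
    vder n α (D n f) = 0 := by
  obtain ⟨N, hN⟩ := exists_bound n α f
  unfold vder
  rw [finsum_eq_sum_of_support_subset (s := Finset.range (N + 1)), partial_sum, hN N le_rfl,
    D_iter_zero, mul_zero]
  intro s hs
  by_contra hlt
  apply hs
  simp only [Finset.coe_range, Set.mem_Iio, not_lt] at hlt
  obtain ⟨t, rfl⟩ : ∃ t, s = t + 1 := ⟨s - 1, by omega⟩
  have h0 : D n (0 : V n) = 0 := map_zero (DD n)
  simp only [comm_succ]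
  rw [hN (t + 1) (by omega), hN t (by omega), h0, add_zero, D_iter_zero, mul_zero]

end
end

section
/- Assume Ψ : W → V is bijective. Then for every pair of families a, b : Fin n → V, every α, β ∈ Fin n and every f ∈ V, the following identity holds: Σ_s ( ∂_{β,s}(b_α) − Σ_{γ,m} ∂_{β,s}(D^m(a_γ))·∂_{γ,m}(G_α) )·D^s(f) = Σ_{γ,m} Ψ(∂^W_{γ,m}(Ψ⁻¹(b_α)))·D^m(L^γ_β(f)) − Σ_γ L^α_γ( Σ_m ∂_{β,m}(a_γ)·D^m(f) ). (Theorem 1 of the paper, the r-deformation formula for the weak quasi-Miura transformation: with b_α in the role of r[t].w_α and a_γ in the role of r[t].v_γ, the coefficient form of the deformation r[w].L^α_β equals the operator form; the third summands of the two sides of the paper's formula are literally identical and have been cancelled.) -/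
open MvPolynomial Function

noncomputable section

/-- A second copy of the algebra of differential polynomials (`w`-coordinates).
Its total derivative `D_W` and partial derivatives `∂^W_{β,m}` are given by the same
`D` and `pderiv` as for `V`. -/
abbrev W (n : ℕ) : Type := MvPolynomial (Fin n × ℕ) ℚ

/-- The jet prolongation `Ψ : W →ₐ V` of a weak quasi-Miura transformation `G`,
determined by `Ψ (w (β,m)) = D^m (G β)`. -/
def Psi (n : ℕ) (G : Fin n → V n) : W n →ₐ[ℚ] V n :=
  MvPolynomial.aeval (fun p : Fin n × ℕ => (D n)^[p.2] (G p.1))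

/-- The linearization operator `L^α_β (f) = Σ_s ∂_{β,s}(G α) · D^s f`. -/
def L (n : ℕ) (G : Fin n → V n) (α β : Fin n) (f : V n) : V n :=
  ∑ᶠ s : ℕ, pderiv (β, s) (G α) * (D n)^[s] f

/-- The formal adjoint `(L*)^α_β (f) = Σ_s (−1)^s D^s (∂_{β,s}(G α) · f)`. -/
def Lstar (n : ℕ) (G : Fin n → V n) (α β : Fin n) (f : V n) : V n :=
  ∑ᶠ s : ℕ, (-1 : V n) ^ s * (D n)^[s] (pderiv (β, s) (G α) * f)

/-- The evolutionary derivation associated to a family `a : Fin n → V n`: the unique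
`ℚ`-linear derivation with `E_a (v (γ,k)) = D^k (a γ)`. -/
def Ederiv (n : ℕ) (a : Fin n → V n) : V n → V n :=
  ⇑(MvPolynomial.mkDerivation ℚ (fun p : Fin n × ℕ => (D n)^[p.2] (a p.1)))

theorem aux_supp {n : ℕ} (φ : V n →ₐ[ℚ] V n) (h : V n) (c : Fin n × ℕ → V n) :
    (Function.support fun p => φ (pderiv p h) * c p) ⊆ (h.vars : Finset (Fin n × ℕ)) := by
  intro p hp
  by_contra hv
  apply hp
  have : pderiv p h = 0 := pderiv_eq_zero_of_notMem_vars (by simpa using hv)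
  simp [this]

theorem aux_fin {n : ℕ} (φ : V n →ₐ[ℚ] V n) (h : V n) (c : Fin n × ℕ → V n) :
    (Function.support fun p => φ (pderiv p h) * c p).Finite :=
  (Finset.finite_toSet _).subset (aux_supp φ h c)

theorem aux_fin0 {n : ℕ} (h : V n) (c : Fin n × ℕ → V n) :
    (Function.support fun p => pderiv p h * c p).Finite :=
  aux_fin (AlgHom.id ℚ _) h c

theorem aux_fin' {n : ℕ} (h : V n) (β : Fin n) (c : ℕ → V n) :
    (Function.support fun s => pderiv (β, s) h * c s).Finite := by
  have := (aux_fin (AlgHom.id ℚ _) h (fun p => c p.2)).preimage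
    (f := fun s : ℕ => (β, s)) (fun _ _ _ _ e => (Prod.mk.inj e).2)
  exact this

/-- chain rule along an algebra hom -/
theorem aux_chain {n : ℕ} (φ : V n →ₐ[ℚ] V n) (E : Derivation ℚ (V n) (V n)) (h : V n) :
    E (φ h) = ∑ᶠ p, φ (pderiv p h) * E (φ (X p)) := by
  induction h using MvPolynomial.induction_on with
  | C r =>
    have : φ (C r) = algebraMap ℚ (V n) r := φ.commutes r
    rw [this]; simp
  | add p q hp hq =>
    rw [map_add, map_add, hp, hq, ← finsum_add_distrib (aux_fin _ _ _) (aux_fin _ _ _)]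
    exact finsum_congr fun x => by rw [map_add, map_add, add_mul]
  | mul_X p i hp =>
    have e : ∀ x, φ (pderiv x (p * X i)) * E (φ (X x))
        = φ (X i) * (φ (pderiv x p) * E (φ (X x)))
          + φ p * (φ (pderiv x (X i)) * E (φ (X x))) := by
      intro x
      rw [Derivation.leibniz, smul_eq_mul, smul_eq_mul, map_add, map_mul, map_mul]; ring
    have f1 := aux_fin φ p (fun x => E (φ (X x)))
    have f2 := aux_fin φ (X i) (fun x => E (φ (X x)))
    have m1 := mul_finsum' (fun x => φ (pderiv x p) * E (φ (X x))) (φ (X i)) f1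
    have m2 := mul_finsum' (fun x => φ (pderiv x (X i)) * E (φ (X x))) (φ p) f2
    have g1 : (Function.support fun x => φ (X i) * (φ (pderiv x p) * E (φ (X x)))).Finite :=
      f1.subset (Function.support_mul_subset_right _ _)
    have g2 : (Function.support fun x => φ p * (φ (pderiv x (X i)) * E (φ (X x)))).Finite :=
      f2.subset (Function.support_mul_subset_right _ _)
    have s2 : ∑ᶠ x, φ (pderiv x (X i)) * E (φ (X x)) = E (φ (X i)) := by
      rw [finsum_eq_single _ i]
      · rw [pderiv_X_self, map_one, one_mul]
      · intro x hx
        rw [pderiv_X_of_ne hx.symm, map_zero, zero_mul]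
    rw [finsum_congr e, finsum_add_distrib g1 g2, ← m1, ← m2, ← hp, s2, map_mul,
      Derivation.leibniz, smul_eq_mul, smul_eq_mul, add_comm]

/-- evolutionary derivation in direction `β` with characteristic `f` -/
def auxE (n : ℕ) (β : Fin n) (f : V n) : Derivation ℚ (V n) (V n) :=
  MvPolynomial.mkDerivation ℚ (fun p : Fin n × ℕ => if p.1 = β then (D n)^[p.2] f else 0)

theorem auxE_eq (n : ℕ) (β : Fin n) (f h : V n) :
    auxE n β f h = ∑ᶠ s : ℕ, pderiv (β, s) h * (D n)^[s] f := by
  have := aux_chain (AlgHom.id ℚ _) (auxE n β f) h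
  simp only [AlgHom.id_apply] at this
  rw [this, finsum_curry _ (aux_fin0 h _), finsum_eq_single _ β]
  · exact finsum_congr fun s => by simp [auxE, mkDerivation_X]
  · intro γ hγ
    simp [auxE, mkDerivation_X, hγ]

def auxD (n : ℕ) : Derivation ℚ (V n) (V n) :=
  MvPolynomial.mkDerivation ℚ (fun p : Fin n × ℕ => (X (p.1, p.2 + 1) : V n))

theorem auxE_comm (n : ℕ) (β : Fin n) (f h : V n) :
    auxE n β f (D n h) = D n (auxE n β f h) := by
  have : ⁅auxE n β f, auxD n⁆ = 0 := by
    apply MvPolynomial.derivation_ext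
    intro p
    rw [Derivation.commutator_apply]
    simp only [auxE, auxD, mkDerivation_X, Derivation.zero_apply]
    split_ifs
    · rw [Function.iterate_succ_apply']; exact sub_self _
    · simp
  have h2 := congrArg (fun d => d h) this
  simp only [Derivation.commutator_apply, Derivation.zero_apply] at h2
  exact sub_eq_zero.mp h2

theorem auxE_comm_iter (n : ℕ) (β : Fin n) (f h : V n) (m : ℕ) :
    auxE n β f ((D n)^[m] h) = (D n)^[m] (auxE n β f h) := by
  induction m with
  | zero => rfl
  | succ m ih => rw [Function.iterate_succ_apply', Function.iterate_succ_apply', auxE_comm, ih]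

/-- Theorem 1 of the paper: the r-deformation formula for the weak quasi-Miura transformation.
With `b α` in the role of `r[t].w_α` and `a γ` in the role of `r[t].v_γ`, the coefficient form
of the deformation `r[w].L^α_β` equals the operator form (the identical third summands of the
two sides having been cancelled). -/
theorem stmt6 (n : ℕ) (hn : 1 ≤ n) (G : Fin n → V n)
    (hΨ : Function.Bijective (Psi n G)) (a b : Fin n → V n) (α β : Fin n) (f : V n) :
    ∑ᶠ s : ℕ,
        (pderiv (β, s) (b α)
          - ∑ᶠ p : Fin n × ℕ, pderiv (β, s) ((D n)^[p.2] (a p.1)) * pderiv p (G α))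
        * (D n)^[s] f
      = (∑ᶠ p : Fin n × ℕ,
            Psi n G (pderiv p (Function.invFun (Psi n G) (b α)))
              * (D n)^[p.2] (L n G p.1 β f))
        - ∑ᶠ γ : Fin n, L n G α γ (∑ᶠ m : ℕ, pderiv (β, m) (a γ) * (D n)^[m] f) := by
  obtain ⟨h, hh⟩ := hΨ.2 (b α)
  have hinv : Function.invFun (Psi n G) (b α) = h := by
    rw [← hh]; exact Function.leftInverse_invFun hΨ.1 h
  have hL : ∀ γ, L n G γ β f = auxE n β f (G γ) := fun γ => (auxE_eq n β f (G γ)).symm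
  have hfirst : (∑ᶠ p : Fin n × ℕ, Psi n G (pderiv p (Function.invFun (Psi n G) (b α)))
              * (D n)^[p.2] (L n G p.1 β f)) = auxE n β f (b α) := by
    rw [hinv, ← hh, aux_chain]
    refine finsum_congr fun p => ?_
    have : Psi n G (X p) = (D n)^[p.2] (G p.1) := by simp [Psi]
    rw [this, auxE_comm_iter, hL]
  have hsecond : ∑ᶠ γ : Fin n, L n G α γ (∑ᶠ m : ℕ, pderiv (β, m) (a γ) * (D n)^[m] f)
      = ∑ᶠ p : Fin n × ℕ, pderiv p (G α) * auxE n β f ((D n)^[p.2] (a p.1)) := by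
    rw [finsum_curry _ (aux_fin0 (G α) _)]
    refine finsum_congr fun γ => finsum_congr fun s => ?_
    rw [auxE_comm_iter, auxE_eq]
  have hS : ∀ c : Fin n × ℕ → V n, ∑ᶠ p : Fin n × ℕ, pderiv p (G α) * c p
      = ∑ p ∈ (G α).vars, pderiv p (G α) * c p := fun c =>
    finsum_eq_sum_of_support_subset _ (aux_supp (AlgHom.id ℚ _) (G α) c)
  have hterm : ∀ s : ℕ, (pderiv (β, s) (b α)
          - ∑ᶠ p : Fin n × ℕ, pderiv (β, s) ((D n)^[p.2] (a p.1)) * pderiv p (G α))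
        * (D n)^[s] f = pderiv (β, s) (b α) * (D n)^[s] f
          - ∑ p ∈ (G α).vars,
            pderiv (β, s) ((D n)^[p.2] (a p.1)) * (pderiv p (G α) * (D n)^[s] f) := by
    intro s
    rw [sub_mul, finsum_congr (fun p => mul_comm _ _), hS, Finset.sum_mul]
    congr 1
    exact Finset.sum_congr rfl fun p _ => by ring
  rw [hfirst, hsecond, hS, finsum_congr hterm, finsum_sub_distrib (aux_fin' _ _ _),
    ← auxE_eq, finsum_sum_comm]
  · congr 1
    refine Finset.sum_congr rfl fun p _ => ?_
    rw [auxE_eq, mul_finsum]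
    exact finsum_congr fun s => by ring
  · intro p _
    exact aux_fin' _ _ _
  · refine ((G α).vars.finite_toSet.biUnion fun p _ =>
      aux_fin' ((D n)^[p.2] (a p.1)) β (fun s => pderiv p (G α) * (D n)^[s] f)).subset ?_
    intro s hs
    obtain ⟨p, hp, hne⟩ := Finset.exists_ne_zero_of_sum_ne_zero hs
    exact Set.mem_biUnion hp hne

end
end
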